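/- arXiv:2412.16743 — 7 statements merged into one kernel-verified Lean document; each statement's English description precedes it below -/
import Mathlib

section
/- Let (φ, ξ, η) be an almost contact metric structure on a finite-dimensional real inner product space (V, g). Let T : V × V → End(V) be a bilinear map such that (i) Alt((x, y, z) ↦ T(x, y)(z)) = 0 (first Bianchi identity), and (ii) there is μ ∈ ℝ with η(T(x, y)(v)) = μ(g(x, v)η(y) − g(y, v)η(x)) for all x, y, v ∈ V. Define R3(x, y)(z) := η(y)η(z)x − η(x)η(z)y. Then Alt((x₁, x₂, x₃, x₄) ↦ T(x₁, x₂) ∘ R3(x₃, x₄)) = 0 and Alt((x₁, x₂, x₃, x₄) ↦ R3(x₁, x₂) ∘ T(x₃, x₄)) = 0 as End(V)-valued alternating 4-multilinear maps. -/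
open scoped RealInnerProductSpace

/-- The alternatization (with the `1/p!` normalization) of a `p`-multilinear map. -/
noncomputable def Alt {V W : Type*} [AddCommGroup W] [Module ℝ W] {n : ℕ}
    (T : (Fin n → V) → W) : (Fin n → V) → W :=
  fun x => (n.factorial : ℝ)⁻¹ •
    ∑ σ : Equiv.Perm (Fin n), (Equiv.Perm.sign σ : ℤ) • T (fun i => x (σ i))

/-- The tensor `R3(x,y)(z) = η(y)η(z)x − η(x)η(z)y`. -/
noncomputable def R3 {V : Type*} [AddCommGroup V] [Module ℝ V]
    (η : V →ₗ[ℝ] ℝ) (x y z : V) : V :=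
  (η y * η z) • x - (η x * η z) • y


lemma sum_perm_succ_aux {W : Type*} [AddCommGroup W] {n : ℕ}
    (F : (Fin (n+1) → Fin (n+1)) → W) :
    ∑ σ : Equiv.Perm (Fin (n+1)), (Equiv.Perm.sign σ : ℤ) • F σ =
    ∑ p : Fin (n+1), ∑ e : Equiv.Perm (Fin n), (Equiv.Perm.sign e : ℤ) •
      ((if p = 0 then (1:ℤ) else -1) •
        F (Fin.cons p (fun i => Equiv.swap 0 p (e i).succ))) := by
  rw [← Equiv.Perm.decomposeFin.symm.sum_comp, Fintype.sum_prod_type]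
  refine Finset.sum_congr rfl fun p _ => Finset.sum_congr rfl fun e _ => ?_
  have h : (⇑(Equiv.Perm.decomposeFin.symm (p, e)) : Fin (n+1) → Fin (n+1)) =
      Fin.cons p (fun i => Equiv.swap 0 p (e i).succ) := by
    funext i
    refine Fin.cases ?_ (fun i => ?_) i <;> simp
  rw [h, Equiv.Perm.decomposeFin.symm_sign]
  split_ifs <;> simp

lemma sum_perm_three_aux {V W : Type*} [AddCommGroup W] (F : V → V → V → W) (x : Fin 3 → V) :
    ∑ σ : Equiv.Perm (Fin 3), (Equiv.Perm.sign σ : ℤ) • F (x (σ 0)) (x (σ 1)) (x (σ 2)) =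
    F (x 0) (x 1) (x 2) - F (x 0) (x 2) (x 1) - F (x 1) (x 0) (x 2) + F (x 1) (x 2) (x 0)
      - F (x 2) (x 1) (x 0) + F (x 2) (x 0) (x 1) := by
  have s1 : Equiv.swap (0 : Fin 3) 1 2 = 2 := by decide
  have s2 : Equiv.swap (0 : Fin 3) 2 1 = 1 := by decide
  rw [sum_perm_succ_aux (fun s => F (x (s 0)) (x (s 1)) (x (s 2)))]
  have e1 : ∀ (p : Fin 3) (g : Fin 2 → Fin 3),
    (Fin.cons p g : Fin 3 → Fin 3) 1 = g 0 := fun _ _ => rfl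
  have e2 : ∀ (p : Fin 3) (g : Fin 2 → Fin 3),
    (Fin.cons p g : Fin 3 → Fin 3) 2 = g 1 := fun _ _ => rfl
  simp only [Fin.cons_zero, e1, e2]
  have h : ∀ G : Fin 2 → Fin 2 → W,
      ∑ e : Equiv.Perm (Fin 2), (Equiv.Perm.sign e : ℤ) • G (e 0) (e 1) = G 0 1 - G 1 0 := by
    intro G
    rw [sum_perm_succ_aux (fun s => G (s 0) (s 1))]
    have e1 : ∀ (p : Fin 2) (g : Fin 1 → Fin 2),
      (Fin.cons p g : Fin 2 → Fin 2) 1 = g 0 := fun _ _ => rfl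
    simp [Fin.sum_univ_two, e1, sub_eq_add_neg]
  rw [Fin.sum_univ_three, h (fun a b => _ • F _ (x (Equiv.swap 0 0 a.succ)) (x (Equiv.swap 0 0 b.succ))),
    h (fun a b => _ • F _ (x (Equiv.swap 0 1 a.succ)) (x (Equiv.swap 0 1 b.succ))),
    h (fun a b => _ • F _ (x (Equiv.swap 0 2 a.succ)) (x (Equiv.swap 0 2 b.succ)))]
  simp [s1, s2]
  abel

lemma sum_perm_four_aux {V W : Type*} [AddCommGroup W] (F : V → V → V → V → W) (x : Fin 4 → V) :
    ∑ σ : Equiv.Perm (Fin 4), (Equiv.Perm.sign σ : ℤ) •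
      F (x (σ 0)) (x (σ 1)) (x (σ 2)) (x (σ 3)) =
    ∑ p : Fin 4, (if p = 0 then (1:ℤ) else -1) • 
      ∑ e : Equiv.Perm (Fin 3), (Equiv.Perm.sign e : ℤ) •
        F (x p) (x (Equiv.swap 0 p (e 0).succ)) (x (Equiv.swap 0 p (e 1).succ))
          (x (Equiv.swap 0 p (e 2).succ)) := by
  rw [sum_perm_succ_aux (fun s => F (x (s 0)) (x (s 1)) (x (s 2)) (x (s 3)))]
  refine Finset.sum_congr rfl fun p _ => ?_
  rw [Finset.smul_sum]
  refine Finset.sum_congr rfl fun e _ => ?_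
  rw [smul_comm]
  rfl

lemma sum_perm_four_aux2 {V W : Type*} [AddCommGroup W] (F : V → V → V → V → W) (x : Fin 4 → V)
    (K : V → V → V → V → W)
    (hK : ∀ p a b c, K p a b c = F p a b c - F p a c b - F p b a c + F p b c a
      - F p c b a + F p c a b) :
    ∑ σ : Equiv.Perm (Fin 4), (Equiv.Perm.sign σ : ℤ) •
      F (x (σ 0)) (x (σ 1)) (x (σ 2)) (x (σ 3)) =
    K (x 0) (x 1) (x 2) (x 3) - K (x 1) (x 0) (x 2) (x 3) - K (x 2) (x 1) (x 0) (x 3)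
      - K (x 3) (x 1) (x 2) (x 0) := by
  rw [sum_perm_four_aux]
  have h : ∀ p : Fin 4, _ := fun p => sum_perm_three_aux (F (x p))
    (fun i : Fin 3 => x (Equiv.swap 0 p i.succ))
  simp only [h, ← hK]
  have s1 : Equiv.swap (0 : Fin 4) 1 2 = 2 := by decide
  have s2 : Equiv.swap (0 : Fin 4) 1 3 = 3 := by decide
  have s3 : Equiv.swap (0 : Fin 4) 2 1 = 1 := by decide
  have s4 : Equiv.swap (0 : Fin 4) 2 3 = 3 := by decide
  have s5 : Equiv.swap (0 : Fin 4) 3 1 = 1 := by decide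
  have s6 : Equiv.swap (0 : Fin 4) 3 2 = 2 := by decide
  have t1 : (Fin.succ 0 : Fin 4) = 1 := rfl
  have t2 : (Fin.succ 1 : Fin 4) = 2 := rfl
  have t3 : (Fin.succ 2 : Fin 4) = 3 := rfl
  simp only [Fin.sum_univ_four, t1, t2, t3, s1, s2, s3, s4, s5, s6, Equiv.swap_self,
    Equiv.refl_apply, Equiv.swap_apply_right]
  simp
  abel

theorem T_comp_R3_alternatization_zero
    {V : Type*} [NormedAddCommGroup V] [InnerProductSpace ℝ V] [FiniteDimensional ℝ V]
    (φ : V →ₗ[ℝ] V) (ξ : V) (η : V →ₗ[ℝ] ℝ)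
    (hφφ : ∀ v, φ (φ v) = -v + η v • ξ)
    (hηξ : η ξ = 1)
    (hφξ : φ ξ = 0)
    (hηφ : ∀ v, η (φ v) = 0)
    (hmetric : ∀ u v, ⟪φ u, φ v⟫ = ⟪u, v⟫ - η u * η v)
    (T : V →ₗ[ℝ] V →ₗ[ℝ] (V →ₗ[ℝ] V))
    (hBianchi : Alt (fun x : Fin 3 → V => T (x 0) (x 1) (x 2)) = 0)
    (hμ : ∃ μ : ℝ, ∀ x y v : V, η (T x y v) = μ * (⟪x, v⟫ * η y - ⟪y, v⟫ * η x)) :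
    Alt (fun x : Fin 4 → V => fun v => T (x 0) (x 1) (R3 η (x 2) (x 3) v)) = 0 ∧
    Alt (fun x : Fin 4 → V => fun v => R3 η (x 0) (x 1) (T (x 2) (x 3) v)) = 0 := by
  have B : ∀ a b c : V, T a b c - T a c b - T b a c + T b c a - T c b a + T c a b = 0 := by
    intro a b c
    have h := congrFun hBianchi ![a, b, c]
    simp only [Alt] at h
    rw [sum_perm_three_aux (fun a b c => T a b c)] at h
    have h2 := (smul_eq_zero.mp h).resolve_left (by positivity)
    simpa using h2
  obtain ⟨μ, hμ⟩ := hμ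
  constructor
  · funext x
    simp only [Alt]
    rw [sum_perm_four_aux2 (fun a b c d => fun v => T a b (R3 η c d v)) x _ (fun _ _ _ _ => rfl)]
    refine smul_eq_zero_of_right _ ?_
    funext v
    simp only [R3, map_sub, map_smul, Pi.sub_apply, Pi.add_apply, Pi.zero_apply]
    generalize x 0 = a
    generalize x 1 = b
    generalize x 2 = c
    generalize x 3 = d
    linear_combination (norm := module) (2 * η d * η v) • B a b c - (2 * η c * η v) • B a b d
      + (2 * η b * η v) • B a c d - (2 * η a * η v) • B b c d
  · funext x
    simp only [Alt]
    rw [sum_perm_four_aux2 (fun a b c d => fun v => R3 η a b (T c d v)) x _ (fun _ _ _ _ => rfl)]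
    refine smul_eq_zero_of_right _ ?_
    funext v
    simp only [R3, hμ, Pi.sub_apply, Pi.add_apply, Pi.zero_apply]
    module
end

section
/- Let (φ, ξ, η) be an almost contact metric structure on a finite-dimensional real inner product space (V, g). Then the following End(V)-valued 4-multilinear maps have vanishing alternatization: (x₁, x₂, x₃, x₄) ↦ R2·1(x₁, x₂) ∘ R2·2(x₃, x₄); (x₁, x₂, x₃, x₄) ↦ R2·2(x₁, x₂) ∘ R2·1(x₃, x₄); and (x₁, x₂, x₃, x₄) ↦ R2·2(x₁, x₂) ∘ R2·2(x₃, x₄). -/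
open scoped RealInnerProductSpace

/-- The fundamental 2-form `Φ(u,v) = g(φ u, v)`. -/
noncomputable def Phi {V : Type*} [NormedAddCommGroup V] [InnerProductSpace ℝ V]
    (φ : V →ₗ[ℝ] V) (u v : V) : ℝ := ⟪φ u, v⟫

/-- The tensor `R2·1`. -/
noncomputable def R21 {V : Type*} [NormedAddCommGroup V] [InnerProductSpace ℝ V]
    (φ : V →ₗ[ℝ] V) (x y z : V) : V :=
  Phi φ x z • φ y - Phi φ y z • φ x + (2 * Phi φ x y) • φ z

/-- The tensor `R2·2`. -/
noncomputable def R22 {V : Type*} [NormedAddCommGroup V] [InnerProductSpace ℝ V]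
    (ξ : V) (η : V →ₗ[ℝ] ℝ) (x y z : V) : V :=
  (2 * η x * η z) • y - (2 * η y * η z) • x + (⟪x, z⟫ * η y - ⟪y, z⟫ * η x) • ξ

theorem perm4_sum_aux {W : Type*} [AddCommGroup W] (F : Fin 4 → Fin 4 → Fin 4 → Fin 4 → W) :
    ∑ σ : Equiv.Perm (Fin 4), (Equiv.Perm.sign σ : ℤ) • F (σ 0) (σ 1) (σ 2) (σ 3) =
      F 0 1 2 3 - F 0 1 3 2 - F 0 2 1 3 + F 0 2 3 1 + F 0 3 1 2 - F 0 3 2 1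
      - F 1 0 2 3 + F 1 0 3 2 + F 1 2 0 3 - F 1 2 3 0 - F 1 3 0 2 + F 1 3 2 0
      + F 2 0 1 3 - F 2 0 3 1 - F 2 1 0 3 + F 2 1 3 0 + F 2 3 0 1 - F 2 3 1 0
      - F 3 0 1 2 + F 3 0 2 1 + F 3 1 0 2 - F 3 1 2 0 - F 3 2 0 1 + F 3 2 1 0 := by
  have h1 : ∀ (n : ℕ) (f : Equiv.Perm (Fin (n+1)) → W), ∑ σ, f σ =
      ∑ p : Fin (n+1), ∑ e : Equiv.Perm (Fin n), f (Equiv.Perm.decomposeFin.symm (p, e)) := by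
    intro n f
    rw [← Fintype.sum_prod_type', ← Equiv.sum_comp Equiv.Perm.decomposeFin.symm]
  have e2 : (2 : Fin 4) = Fin.succ 1 := rfl
  have e3 : (3 : Fin 4) = Fin.succ 2 := rfl
  have e23 : (2 : Fin 3) = Fin.succ 1 := rfl
  have e14 : (1 : Fin 4) = Fin.succ 0 := rfl
  have e13 : (1 : Fin 3) = Fin.succ 0 := rfl
  have e12 : (1 : Fin 2) = Fin.succ 0 := rfl
  rw [h1]
  simp only [h1 2, h1 1, h1 0, Fin.sum_univ_succ, Finset.univ_unique, Finset.sum_singleton, Fin.sum_univ_zero]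
  simp only [Equiv.Perm.decomposeFin.symm_sign, e2, e3, e23, e14, e13, e12,
    Equiv.Perm.decomposeFin_symm_apply_zero, Equiv.Perm.decomposeFin_symm_apply_succ]
  simp [Equiv.swap_apply_def, Fin.ext_iff]
  abel

theorem R21_R22_compositions_alternatization_zero
    {V : Type*} [NormedAddCommGroup V] [InnerProductSpace ℝ V] [FiniteDimensional ℝ V]
    (φ : V →ₗ[ℝ] V) (ξ : V) (η : V →ₗ[ℝ] ℝ)
    (hφφ : ∀ v, φ (φ v) = -v + η v • ξ)
    (hηξ : η ξ = 1)
    (hφξ : φ ξ = 0)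
    (hηφ : ∀ v, η (φ v) = 0)
    (hmetric : ∀ u v, ⟪φ u, φ v⟫ = ⟪u, v⟫ - η u * η v) :
    Alt (fun x : Fin 4 → V => fun v => R21 φ (x 0) (x 1) (R22 ξ η (x 2) (x 3) v)) = 0 ∧
    Alt (fun x : Fin 4 → V => fun v => R22 ξ η (x 0) (x 1) (R21 φ (x 2) (x 3) v)) = 0 ∧
    Alt (fun x : Fin 4 → V => fun v => R22 ξ η (x 0) (x 1) (R22 ξ η (x 2) (x 3) v)) = 0 := by
  have hξ : ∀ u, ⟪u, ξ⟫ = η u := by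
    intro u
    have := hmetric u ξ
    rw [hφξ, inner_zero_right, hηξ] at this
    linarith
  have hskew : ∀ u v, ⟪u, φ v⟫ = - ⟪φ u, v⟫ := by
    intro u v
    have := hmetric u (φ v)
    rw [hφφ, hηφ, inner_add_right, inner_neg_right, inner_smul_right, hξ, hηφ] at this
    linarith
  have hsk2 : ∀ u v, ⟪φ u, v⟫ = - ⟪φ v, u⟫ := by
    intro u v
    rw [real_inner_comm, hskew]
  have key : ∀ G : V → V → V → V → V → V,
      (∀ a b c d v, G a b c d v - G a b d c v - G a c b d v + G a c d b v + G a d b c v - G a d c b v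
      - G b a c d v + G b a d c v + G b c a d v - G b c d a v - G b d a c v + G b d c a v
      + G c a b d v - G c a d b v - G c b a d v + G c b d a v + G c d a b v - G c d b a v
      - G d a b c v + G d a c b v + G d b a c v - G d b c a v - G d c a b v + G d c b a v = 0) →
      Alt (fun x : Fin 4 → V => fun v => G (x 0) (x 1) (x 2) (x 3) v) = 0 := by
    intro G hG
    funext x v
    unfold Alt
    rw [perm4_sum_aux (fun i j k l => fun v => G (x i) (x j) (x k) (x l) v)]
    simp only [Pi.smul_apply, Pi.sub_apply, Pi.add_apply, Pi.zero_apply]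
    rw [hG, smul_zero]
  refine ⟨key (fun a b c d v => R21 φ a b (R22 ξ η c d v)) ?_,
    key (fun a b c d v => R22 ξ η a b (R21 φ c d v)) ?_,
    key (fun a b c d v => R22 ξ η a b (R22 ξ η c d v)) ?_⟩
  · intro a b c d v
    simp only [R21, R22, Phi, map_add, map_sub, map_smul, hφξ, hξ, hηφ, inner_add_right,
      inner_sub_right, inner_smul_right, smul_zero, mul_zero, add_zero]
    rw [hsk2 b a, hsk2 c a, hsk2 d a, hsk2 c b, hsk2 d b, hsk2 d c]
    module
  · intro a b c d v
    simp only [R21, R22, Phi, map_add, map_sub, map_smul, hηφ, inner_add_right,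
      inner_sub_right, inner_smul_right, smul_zero, mul_zero, add_zero, smul_eq_mul, hskew]
    rw [hsk2 b a, hsk2 c a, hsk2 d a, hsk2 c b, hsk2 d b, hsk2 d c]
    module
  · intro a b c d v
    simp only [R22, map_add, map_sub, map_smul, hηξ, hξ, inner_add_right,
      inner_sub_right, inner_smul_right, smul_eq_mul]
    rw [real_inner_comm a b, real_inner_comm a c, real_inner_comm a d, real_inner_comm b c,
      real_inner_comm b d, real_inner_comm c d]
    module
end

section
/- Let V be a finite-dimensional real vector space, η : V → ℝ a linear functional, and T : V × V → End(V) a bilinear map satisfying the first Bianchi identity Alt((x, y, z) ↦ T(x, y)(z)) = 0. For k ≥ 1 define the (2k+1)-multilinear form S on V by S(x₁, x₂, …, x_{2k+1}) := η( T(x₂, x₃)( T(x₄, x₅)( ⋯ ( T(x_{2k}, x_{2k+1})(x₁) ) ⋯ ) ) ). Then Alt(S) = 0. -/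
/-- The nested vector `T(x₂,x₃)(T(x₄,x₅)(⋯(T(x_{2k},x_{2k+1})(x₁))⋯))`
(in `0`-indexed form: `T(x 1, x 2)(T(x 3, x 4)(⋯(T(x (2k-1), x (2k))(x 0))⋯))`). -/
noncomputable def chainT {V : Type*} [AddCommGroup V] [Module ℝ V]
    (T : V →ₗ[ℝ] V →ₗ[ℝ] (V →ₗ[ℝ] V)) (k : ℕ) (x : Fin (2 * k + 1) → V) : V :=
  (List.range k).foldl
    (fun v j => T (x ⟨2 * (k - j) - 1, by omega⟩) (x ⟨2 * (k - j), by omega⟩) v)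
    (x ⟨0, by omega⟩)

theorem foldl_lin_aux {V : Type*} [AddCommGroup V] [Module ℝ V]
    (g : ℕ → V →ₗ[ℝ] V) (l : List ℕ) :
    ∃ M : V →ₗ[ℝ] V, ∀ v, l.foldl (fun v j => g j v) v = M v := by
  induction l with
  | nil => exact ⟨LinearMap.id, fun v => rfl⟩
  | cons a l ih =>
    obtain ⟨M, hM⟩ := ih
    exact ⟨M ∘ₗ g a, fun v => by simp [hM]⟩

theorem chain_aux {V : Type*} [AddCommGroup V] [Module ℝ V]
    (T : V →ₗ[ℝ] V →ₗ[ℝ] (V →ₗ[ℝ] V)) (m : ℕ) (y : Fin (2 * (m + 1) + 1) → V) :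
    ∃ M : V →ₗ[ℝ] V, ∀ z : Fin (2 * (m + 1) + 1) → V,
      (∀ i : Fin (2 * (m + 1) + 1), 1 ≤ i.val → i.val ≤ 2 * m → z i = y i) →
      chainT T (m + 1) z =
        M (T (z ⟨2 * m + 1, by omega⟩) (z ⟨2 * m + 2, by omega⟩) (z ⟨0, by omega⟩)) := by
  obtain ⟨M, hM⟩ := foldl_lin_aux
    (fun j => T (y ⟨2 * (m + 1 - (j + 1)) - 1, by omega⟩) (y ⟨2 * (m + 1 - (j + 1)), by omega⟩))
    (List.range m)
  refine ⟨M, fun z hz => ?_⟩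
  rw [← hM]
  unfold chainT
  rw [List.range_succ_eq_map, List.foldl_cons, List.foldl_map]
  apply List.foldl_ext
  intro v j hj
  rw [List.mem_range] at hj
  have h1 := hz ⟨2 * (m + 1 - (j + 1)) - 1, by omega⟩ (by simp only; omega) (by simp only; omega)
  have h2 := hz ⟨2 * (m + 1 - (j + 1)), by omega⟩ (by simp only; omega) (by simp only; omega)
  simp only [Nat.succ_eq_add_one]
  rw [h1, h2]

theorem alternatization_of_eta_chain_zero
    {V : Type*} [AddCommGroup V] [Module ℝ V] [FiniteDimensional ℝ V]
    (η : V →ₗ[ℝ] ℝ)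
    (T : V →ₗ[ℝ] V →ₗ[ℝ] (V →ₗ[ℝ] V))
    (hBianchi : Alt (fun x : Fin 3 → V => T (x 0) (x 1) (x 2)) = 0)
    (k : ℕ) (hk : 1 ≤ k) :
    Alt (fun x : Fin (2 * k + 1) → V => η (chainT T k x)) = 0 := by
  obtain ⟨m, rfl⟩ : ∃ m, k = m + 1 := ⟨k - 1, by omega⟩
  have hB : ∀ w : Fin 3 → V, ∑ τ : Equiv.Perm (Fin 3),
      (Equiv.Perm.sign τ : ℤ) • T (w (τ 0)) (w (τ 1)) (w (τ 2)) = 0 := by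
    intro w
    have h := congrFun hBianchi w
    simp only [Alt, Pi.zero_apply] at h
    exact (smul_eq_zero.mp h).resolve_left (by positivity)
  let f : Fin 3 ↪ Fin (2 * (m + 1) + 1) :=
    ⟨![⟨2 * m + 1, by omega⟩, ⟨2 * m + 2, by omega⟩, ⟨0, by omega⟩], by
      intro a b h
      fin_cases a <;> fin_cases b <;> simp at h ⊢⟩
  have f0 : f 0 = ⟨2 * m + 1, by omega⟩ := rfl
  have f1 : f 1 = ⟨2 * m + 2, by omega⟩ := rfl
  have f2 : f 2 = ⟨0, by omega⟩ := rfl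
  have key : ∀ y : Fin (2 * (m + 1) + 1) → V, ∑ τ : Equiv.Perm (Fin 3),
      (Equiv.Perm.sign τ : ℤ) •
        η (chainT T (m + 1) (fun i => y (τ.viaFintypeEmbedding f i))) = 0 := by
    intro y
    obtain ⟨M, hM⟩ := chain_aux T m y
    have := congrArg (fun v => η (M v)) (hB (y ∘ f))
    simp only [map_sum, map_zsmul, map_zero] at this
    rw [← this]
    refine Finset.sum_congr rfl fun τ _ => ?_
    rw [hM]
    · rw [← f0, ← f1, ← f2]
      simp only [Equiv.Perm.viaFintypeEmbedding_apply_image, Function.comp]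
    · intro i h1 h2
      rw [Equiv.Perm.viaFintypeEmbedding_apply_notMem_range]
      rintro ⟨a, rfl⟩
      fin_cases a
      · change 2 * m + 1 ≤ 2 * m at h2; omega
      · change 2 * m + 2 ≤ 2 * m at h2; omega
      · change 1 ≤ 0 at h1; omega
  funext x
  simp only [Alt, Pi.zero_apply]
  refine smul_eq_zero_of_right _ ?_
  set S := ∑ σ : Equiv.Perm (Fin (2 * (m + 1) + 1)),
    (Equiv.Perm.sign σ : ℤ) • η (chainT T (m + 1) (fun i => x (σ i))) with hS
  have h6 : ∑ _τ : Equiv.Perm (Fin 3), S = 0 := by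
    have : ∀ τ : Equiv.Perm (Fin 3), S = ∑ σ : Equiv.Perm (Fin (2 * (m + 1) + 1)),
        (Equiv.Perm.sign σ : ℤ) • ((Equiv.Perm.sign τ : ℤ) •
          η (chainT T (m + 1) (fun i => x (σ (τ.viaFintypeEmbedding f i))))) := by
      intro τ
      rw [hS, ← Equiv.sum_comp (Equiv.mulRight (τ.viaFintypeEmbedding f))]
      refine Finset.sum_congr rfl fun σ _ => ?_
      simp only [Equiv.coe_mulRight, Equiv.Perm.sign_mul, Equiv.Perm.viaFintypeEmbedding_sign,
        Units.val_mul, mul_smul, Equiv.Perm.mul_apply]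
    rw [Finset.sum_congr rfl fun τ _ => this τ, Finset.sum_comm]
    refine Finset.sum_eq_zero fun σ _ => ?_
    rw [← Finset.smul_sum, key (fun i => x (σ i)), smul_zero]
  rw [Finset.sum_const] at h6
  refine (smul_eq_zero.mp h6).resolve_left ?_
  simp [Fintype.card_perm, Nat.factorial]
end

section
/- Let (φ, ξ, η) be an almost contact metric structure on a finite-dimensional real inner product space (V, g). Then Alt((x₁, …, x₈) ↦ A′(x₁, x₂, x₃, x₄) ∘ A′(x₅, x₆, x₇, x₈)) = Alt((x₁, …, x₈) ↦ −16 · Φ(x₁, x₂)Φ(x₃, x₄)Φ(x₅, x₆) · B*(x₇, x₈)) as End(V)-valued alternating 8-multilinear maps. -/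
open scoped RealInnerProductSpace

/-- `B*(x,y) = B1(x,y) + B2(x,y) + B3(x,y)`. -/
noncomputable def Bstar {V : Type*} [NormedAddCommGroup V] [InnerProductSpace ℝ V]
    (φ : V →ₗ[ℝ] V) (x y : V) : V → V := fun v =>
  -(⟪φ (φ x), v⟫ • φ y) + ⟪φ x, v⟫ • φ (φ y) + Phi φ x y • φ (φ v)

/-- `A′(x₁,x₂,x₃,x₄) = 4 Φ(x₁,x₂) B*(x₃,x₄)`. -/
noncomputable def Aprime {V : Type*} [NormedAddCommGroup V] [InnerProductSpace ℝ V]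
    (φ : V →ₗ[ℝ] V) (x₁ x₂ x₃ x₄ : V) : V → V :=
  (4 * Phi φ x₁ x₂) • Bstar φ x₃ x₄

theorem sum_sign_zero {V W : Type*} [AddCommGroup W] [Module ℝ W] {n : ℕ}
    (U : (Fin n → V) → W) (i j : Fin n) (hij : i ≠ j)
    (hU : ∀ x : Fin n → V, U (fun k => x (Equiv.swap i j k)) = U x) (x : Fin n → V) :
    ∑ σ : Equiv.Perm (Fin n), (Equiv.Perm.sign σ : ℤ) • U (fun k => x (σ k)) = 0 := by
  refine Finset.sum_involution (fun σ _ => σ * Equiv.swap i j) ?_ ?_ ?_ ?_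
  · intro σ _
    have h := hU (fun k => x (σ k))
    simp only [Equiv.Perm.mul_apply, Equiv.Perm.sign_mul, Equiv.Perm.sign_swap hij]
    rw [h]
    simp
  · intro σ _ _ h
    have h2 : Equiv.swap i j = 1 := by simpa using h
    exact hij (Equiv.swap_eq_one_iff.mp h2)
  · intro σ _
    simp
  · intro σ _
    simp [mul_assoc]

theorem Alt_congr_sym {V W : Type*} [AddCommGroup W] [Module ℝ W] {n : ℕ}
    (T T' U U' : (Fin n → V) → W) (i j i' j' : Fin n) (hij : i ≠ j) (hij' : i' ≠ j')
    (hU : ∀ x : Fin n → V, U (fun k => x (Equiv.swap i j k)) = U x)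
    (hU' : ∀ x : Fin n → V, U' (fun k => x (Equiv.swap i' j' k)) = U' x)
    (h : ∀ x, T x = T' x + U x + U' x) : Alt T = Alt T' := by
  funext x
  unfold Alt
  congr 1
  simp only [h, smul_add, Finset.sum_add_distrib]
  rw [sum_sign_zero U i j hij hU, sum_sign_zero U' i' j' hij' hU']
  simp

theorem Aprime_squared_alternatization
    {V : Type*} [NormedAddCommGroup V] [InnerProductSpace ℝ V] [FiniteDimensional ℝ V]
    (φ : V →ₗ[ℝ] V) (ξ : V) (η : V →ₗ[ℝ] ℝ)
    (hφφ : ∀ v, φ (φ v) = -v + η v • ξ)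
    (hηξ : η ξ = 1)
    (hφξ : φ ξ = 0)
    (hηφ : ∀ v, η (φ v) = 0)
    (hmetric : ∀ u v, ⟪φ u, φ v⟫ = ⟪u, v⟫ - η u * η v) :
    Alt (fun x : Fin 8 → V =>
        (Aprime φ (x 0) (x 1) (x 2) (x 3)) ∘ (Aprime φ (x 4) (x 5) (x 6) (x 7))) =
    Alt (fun x : Fin 8 → V =>
        (-16 * Phi φ (x 0) (x 1) * Phi φ (x 2) (x 3) * Phi φ (x 4) (x 5)) •
          Bstar φ (x 6) (x 7)) := by
  have hξ : ∀ u, ⟪φ u, ξ⟫ = 0 := by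
    intro u
    have := hmetric (φ u) ξ
    rw [hφξ, hηφ] at this
    simpa using this.symm
  have h3 : ∀ v, φ (φ (φ v)) = - φ v := by
    intro v
    rw [hφφ (φ v), hηφ]; simp
  have skew : ∀ u v, ⟪u, φ v⟫ = -⟪φ u, v⟫ := by
    intro u v
    have := hmetric u (φ v)
    rw [hηφ, hφφ, inner_add_right, inner_smul_right, hξ, inner_neg_right] at this
    linarith
  have hG : ∀ u v, ⟪φ u, φ v⟫ = ⟪φ v, φ u⟫ := fun u v => real_inner_comm _ _
  refine Alt_congr_sym _ _
    (fun x v => (16 * ⟪φ (x 0), x 1⟫ * ⟪φ (x 4), x 5⟫) •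
      (⟪φ (x 6), x 7⟫ • (⟪φ (φ (x 2)), v⟫ • φ (x 3) - ⟪φ (x 2), v⟫ • φ (φ (x 3)))
       + ⟪φ (x 2), x 7⟫ • (⟪φ (φ (x 6)), v⟫ • φ (x 3) - ⟪φ (x 6), v⟫ • φ (φ (x 3)))))
    (fun x v => (16 * ⟪φ (x 0), x 1⟫ * ⟪φ (x 4), x 5⟫ * ⟪φ (x 2), φ (x 7)⟫) •
      (-(⟪φ (x 6), v⟫ • φ (x 3)) - ⟪φ (φ (x 6)), v⟫ • φ (φ (x 3))))
    2 6 2 7 (by decide) (by decide) ?_ ?_ ?_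
  · intro x
    have e (k : Fin 8) (h2 : k ≠ 2) (h6 : k ≠ 6) : Equiv.swap (2 : Fin 8) 6 k = k :=
      Equiv.swap_apply_of_ne_of_ne h2 h6
    funext v
    simp only [Equiv.swap_apply_left, Equiv.swap_apply_right, e 0 (by decide) (by decide),
      e 1 (by decide) (by decide), e 3 (by decide) (by decide), e 4 (by decide) (by decide),
      e 5 (by decide) (by decide), e 7 (by decide) (by decide)]
    rw [add_comm]
  · intro x
    have e (k : Fin 8) (h2 : k ≠ 2) (h6 : k ≠ 7) : Equiv.swap (2 : Fin 8) 7 k = k :=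
      Equiv.swap_apply_of_ne_of_ne h2 h6
    funext v
    simp only [Equiv.swap_apply_left, Equiv.swap_apply_right, e 0 (by decide) (by decide),
      e 1 (by decide) (by decide), e 3 (by decide) (by decide), e 4 (by decide) (by decide),
      e 5 (by decide) (by decide), e 6 (by decide) (by decide)]
    rw [hG (x 7) (x 2)]
  · intro x
    funext v
    simp only [Aprime, Bstar, Phi, Function.comp_apply, Pi.smul_apply, Pi.add_apply,
      map_add, map_neg, map_smul, inner_add_right, inner_neg_right, inner_smul_right, h3, skew,
      inner_neg_left, map_neg]
    module
end

section
/- Let (φ, ξ, η) be an almost contact metric structure on a finite-dimensional real inner product space (V, g). Then for every integer r ≥ 1, Alt((A′)^{(r)}) = Alt((x₁, …, x_{4r}) ↦ (−1)^{r−1} 4^r · Φ(x₁, x₂)Φ(x₃, x₄)⋯Φ(x_{4r−3}, x_{4r−2}) · B*(x_{4r−1}, x_{4r})) as End(V)-valued alternating 4r-multilinear maps (the product on the right contains 2r−1 factors of Φ). -/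
open scoped RealInnerProductSpace

/-- `(A′)^{(r)}(x₁,…,x_{4r}) = A′(x₁,…,x₄) ∘ A′(x₅,…,x₈) ∘ ⋯ ∘ A′(x_{4r−3},…,x_{4r})`. -/
noncomputable def AprimeIter {V : Type*} [NormedAddCommGroup V] [InnerProductSpace ℝ V]
    (φ : V →ₗ[ℝ] V) (r : ℕ) (x : Fin (4 * r) → V) : V → V :=
  (List.finRange r).foldr
    (fun (j : Fin r) (f : V → V) =>
      (Aprime φ (x ⟨4 * (j : ℕ), by have := j.2; omega⟩)
        (x ⟨4 * (j : ℕ) + 1, by have := j.2; omega⟩)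
        (x ⟨4 * (j : ℕ) + 2, by have := j.2; omega⟩)
        (x ⟨4 * (j : ℕ) + 3, by have := j.2; omega⟩)) ∘ f)
    id


noncomputable def BL {V : Type*} [NormedAddCommGroup V] [InnerProductSpace ℝ V]
    (φ : V →ₗ[ℝ] V) (x y : V) : V →ₗ[ℝ] V where
  toFun := Bstar φ x y
  map_add' u v := by simp only [Bstar, inner_add_right, map_add]; module
  map_smul' c v := by simp only [Bstar, inner_smul_right, map_smul, RingHom.id_apply]; module

noncomputable def CC {V : Type*} [AddCommGroup V] [Module ℝ V]
    (S : ℕ → V →ₗ[ℝ] V) : ℕ → V →ₗ[ℝ] V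
  | 0 => LinearMap.id
  | m + 1 => (CC S m).comp (S m)

theorem CC_smul {V : Type*} [AddCommGroup V] [Module ℝ V]
    (S : ℕ → V →ₗ[ℝ] V) (s : ℕ → ℝ) (m : ℕ) :
    CC (fun j => s j • S j) m = (∏ j ∈ Finset.range m, s j) • CC S m := by
  induction m with
  | zero => simp [CC]
  | succ m ih =>
    simp only [CC, ih, Finset.prod_range_succ, LinearMap.smul_comp, LinearMap.comp_smul, smul_smul, mul_comm]

theorem CC_congr {V : Type*} [AddCommGroup V] [Module ℝ V]
    (S S' : ℕ → V →ₗ[ℝ] V) (m : ℕ) (h : ∀ j < m, S j = S' j) : CC S m = CC S' m := by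
  induction m with
  | zero => rfl
  | succ m ih =>
    simp only [CC]
    rw [ih (fun j hj => h j (by omega)), h m (by omega)]

theorem foldr_CC {V : Type*} [AddCommGroup V] [Module ℝ V]
    (S : ℕ → V →ₗ[ℝ] V) (m : ℕ) (h : V → V) (v : V) :
    (List.finRange m).foldr (fun (j : Fin m) (f : V → V) => (S j : V → V) ∘ f) h v
      = CC S m (h v) := by
  induction m generalizing h with
  | zero => simp [CC]
  | succ m ih =>
    rw [List.finRange_succ_last, List.foldr_append, List.foldr_map]
    simp only [Fin.val_castSucc]
    rw [ih]
    simp [CC]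

theorem Alt_add {V W : Type*} [AddCommGroup W] [Module ℝ W] {n : ℕ}
    (S T : (Fin n → V) → W) : Alt (fun x => S x + T x) = fun x => Alt S x + Alt T x := by
  funext x
  simp only [Alt, smul_add, Finset.sum_add_distrib]

theorem Alt_zero_of {V W : Type*} [AddCommGroup W] [Module ℝ W] {n : ℕ}
    (T : (Fin n → V) → W) (a b : Fin n) (hab : a ≠ b)
    (h : ∀ x, T (fun i => x (Equiv.swap a b i)) = T x) : Alt T = 0 := by
  funext x
  simp only [Alt, Pi.zero_apply]
  have key : ∑ σ : Equiv.Perm (Fin n), (Equiv.Perm.sign σ : ℤ) • T (fun i => x (σ i))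
     = - ∑ σ : Equiv.Perm (Fin n), (Equiv.Perm.sign σ : ℤ) • T (fun i => x (σ i)) := by
    conv_lhs => rw [← Equiv.sum_comp (Equiv.mulRight (Equiv.swap a b))]
    rw [← Finset.sum_neg_distrib]
    refine Finset.sum_congr rfl fun σ _ => ?_
    have := h (fun i => x (σ i))
    simp only [Equiv.coe_mulRight, Equiv.Perm.sign_mul, Equiv.Perm.sign_swap hab,
      Equiv.Perm.mul_apply, this]
    simp
  have h2 : (2:ℝ) • ∑ σ : Equiv.Perm (Fin n), (Equiv.Perm.sign σ : ℤ) • T (fun i => x (σ i)) = 0 := by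
    rw [two_smul]; nth_rewrite 1 [key]; simp
  rw [(smul_eq_zero.1 h2).resolve_left (by norm_num), smul_zero]

theorem key_step {V : Type*} [NormedAddCommGroup V] [InnerProductSpace ℝ V]
    (φ : V →ₗ[ℝ] V) (hs : ∀ u v, ⟪φ u, v⟫ = -⟪u, φ v⟫) (h3 : ∀ v, φ (φ (φ v)) = - φ v)
    {n : ℕ} (L : (Fin n → V) → (V →ₗ[ℝ] V)) (a b c d : Fin n)
    (hac : a ≠ c) (had : a ≠ d) (hbc : b ≠ c) (hbd : b ≠ d) (hcd : c ≠ d) (hab : a ≠ b)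
    (hL : ∀ τ : Equiv.Perm (Fin n), (∀ i, i ≠ a → i ≠ b → i ≠ c → i ≠ d → τ i = i) →
      ∀ x, L (fun i => x (τ i)) = L x) (v : V) :
    Alt (fun x => L x (BL φ (x a) (x b) (BL φ (x c) (x d) v)))
      = Alt (fun x => L x ((- Phi φ (x a) (x b)) • BL φ (x c) (x d) v)) := by
  have e : ∀ x : Fin n → V, L x (BL φ (x a) (x b) (BL φ (x c) (x d) v)) =
     (L x ((- Phi φ (x a) (x b)) • BL φ (x c) (x d) v)
      + L x ((⟪φ (φ (x c)), v⟫ * ⟪φ (x a), x d⟫ + ⟪φ (φ (x a)), v⟫ * ⟪φ (x c), x d⟫) • φ (x b)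
          - (⟪φ (x c), v⟫ * ⟪φ (x a), x d⟫ + ⟪φ (x a), v⟫ * ⟪φ (x c), x d⟫) • φ (φ (x b))))
      + L x (-((⟪φ (x c), v⟫ * ⟪φ (x a), φ (x d)⟫) • φ (x b))
          - (⟪φ (φ (x c)), v⟫ * ⟪φ (x a), φ (x d)⟫) • φ (φ (x b))) := by
    intro x
    rw [← map_add, ← map_add]
    congr 1
    have i1 : ∀ u w, ⟪φ (φ u), φ w⟫ = ⟪φ u, w⟫ := by
      intro u w
      have := hs (φ (φ u)) w
      rw [h3, inner_neg_left] at this; linarith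
    have i2 : ∀ u w, ⟪φ u, φ (φ w)⟫ = -⟪φ u, w⟫ := by
      intro u w
      rw [← i1 u w, hs (φ u) (φ w)]; ring
    have i3 : ∀ u, ⟪φ u, φ v⟫ = -⟪φ (φ u), v⟫ := by
      intro u
      rw [hs (φ u) v]; ring
    simp only [BL, LinearMap.coe_mk, AddHom.coe_mk, Bstar, Phi, inner_add_right, inner_neg_right,
      inner_smul_right, i1, i2, i3, inner_neg_left, map_add, map_neg, map_smul, h3]
    module
  simp only [e]
  rw [Alt_add, Alt_add]
  rw [Alt_zero_of (V := V) (fun x => L x ((⟪φ (φ (x c)), v⟫ * ⟪φ (x a), x d⟫ + ⟪φ (φ (x a)), v⟫ * ⟪φ (x c), x d⟫) • φ (x b)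
          - (⟪φ (x c), v⟫ * ⟪φ (x a), x d⟫ + ⟪φ (x a), v⟫ * ⟪φ (x c), x d⟫) • φ (φ (x b)))) a c hac,
    Alt_zero_of (V := V) (fun x => L x (-((⟪φ (x c), v⟫ * ⟪φ (x a), φ (x d)⟫) • φ (x b))
          - (⟪φ (φ (x c)), v⟫ * ⟪φ (x a), φ (x d)⟫) • φ (φ (x b)))) a d had]
  · simp
  · intro x
    rw [hL _ (fun i h1 h2 h3 h4 => Equiv.swap_apply_of_ne_of_ne h1 h4)]
    simp only [Equiv.swap_apply_left, Equiv.swap_apply_right,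
      Equiv.swap_apply_of_ne_of_ne hab.symm hbd, Equiv.swap_apply_of_ne_of_ne hac.symm hcd]
    rw [real_inner_comm (φ (x a)) (φ (x d))]
  · intro x
    rw [hL _ (fun i h1 h2 h3 h4 => Equiv.swap_apply_of_ne_of_ne h1 h3)]
    simp only [Equiv.swap_apply_left, Equiv.swap_apply_right,
      Equiv.swap_apply_of_ne_of_ne hab.symm hbc, Equiv.swap_apply_of_ne_of_ne had.symm hcd.symm]
    congr 1
    module

theorem main_ind {V : Type*} [NormedAddCommGroup V] [InnerProductSpace ℝ V]
    (φ : V →ₗ[ℝ] V) (hs : ∀ u v, ⟪φ u, v⟫ = -⟪u, φ v⟫) (h3 : ∀ v, φ (φ (φ v)) = - φ v)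
    {n : ℕ} (a b : ℕ → Fin n) (c d : Fin n) (hcd : c ≠ d) (v : V) (m : ℕ)
    (f : (Fin n → V) → ℝ)
    (hf : ∀ τ : Equiv.Perm (Fin n), (∀ i, (∀ j < m, i ≠ a j ∧ i ≠ b j) → i ≠ c → i ≠ d → τ i = i) →
      ∀ x, f (fun i => x (τ i)) = f x)
    (h1 : ∀ j < m, a j ≠ c ∧ a j ≠ d ∧ b j ≠ c ∧ b j ≠ d ∧ a j ≠ b j)
    (h2 : ∀ j < m, ∀ k < j, a j ≠ a k ∧ a j ≠ b k ∧ b j ≠ a k ∧ b j ≠ b k) :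
    Alt (fun x => f x • CC (fun j => BL φ (x (a j)) (x (b j))) m (BL φ (x c) (x d) v))
      = Alt (fun x => (f x * ∏ j ∈ Finset.range m, (- Phi φ (x (a j)) (x (b j)))) •
          BL φ (x c) (x d) v) := by
  induction m generalizing f with
  | zero => simp [CC]
  | succ m ih =>
    obtain ⟨p1, p2, p3, p4, p5⟩ := h1 m (by omega)
    have := key_step φ hs h3 (fun x => f x • CC (fun j => BL φ (x (a j)) (x (b j))) m)
      (a m) (b m) c d p1 p2 p3 p4 hcd p5 (by
        intro τ hτ x
        dsimp only
        rw [hf τ (fun i q1 q2 q3 => hτ i (q1 m (by omega)).1 (q1 m (by omega)).2 q2 q3)]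
        congr 1
        apply CC_congr
        intro j hj
        have q := h2 m (by omega) j hj
        have r := h1 j (by omega)
        rw [hτ (a j) q.1.symm q.2.2.1.symm r.1 r.2.1,
          hτ (b j) q.2.1.symm q.2.2.2.symm r.2.2.1 r.2.2.2.1]) v
    simp only [LinearMap.smul_apply, map_smul] at this
    simp only [CC, LinearMap.comp_apply]
    rw [this]
    have := ih (fun x => (- Phi φ (x (a m)) (x (b m))) * f x) (by
        intro τ hτ x
        dsimp only
        rw [hf τ (fun i q1 q2 q3 => hτ i (fun j hj => q1 j (by omega)) q2 q3)]
        rw [hτ (a m) (fun j hj => ⟨(h2 m (by omega) j hj).1, (h2 m (by omega) j hj).2.1⟩) p1 p2,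
          hτ (b m) (fun j hj => ⟨(h2 m (by omega) j hj).2.2.1, (h2 m (by omega) j hj).2.2.2⟩) p3 p4])
      (fun j hj => h1 j (by omega)) (fun j hj => h2 j (by omega))
    simp only [smul_smul]
    rw [this]
    congr 1
    funext x
    rw [Finset.prod_range_succ]
    congr 1
    ring

theorem prod_split (F : ℕ → ℝ) (m : ℕ) :
    (∏ j ∈ Finset.range (m + 1), (4 * F (2 * j))) * ∏ j ∈ Finset.range m, (- F (2 * j + 1))
      = (-1) ^ m * 4 ^ (m + 1) * ∏ i ∈ Finset.range (2 * m + 1), F i := by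
  induction m with
  | zero => simp
  | succ m ih =>
    rw [Finset.prod_range_succ, Finset.prod_range_succ (fun j => - F (2 * j + 1)),
      show 2 * (m + 1) + 1 = 2 * m + 1 + 1 + 1 by ring, Finset.prod_range_succ _ (2 * m + 1 + 1),
      Finset.prod_range_succ _ (2 * m + 1), show 2 * (m + 1) = 2 * m + 1 + 1 by ring]
    linear_combination (-4 * F (2 * m + 1) * F (2 * m + 1 + 1)) * ih

theorem AprimeIter_alternatization
    {V : Type*} [NormedAddCommGroup V] [InnerProductSpace ℝ V] [FiniteDimensional ℝ V]
    (φ : V →ₗ[ℝ] V) (ξ : V) (η : V →ₗ[ℝ] ℝ)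
    (hφφ : ∀ v, φ (φ v) = -v + η v • ξ)
    (hηξ : η ξ = 1)
    (hφξ : φ ξ = 0)
    (hηφ : ∀ v, η (φ v) = 0)
    (hmetric : ∀ u v, ⟪φ u, φ v⟫ = ⟪u, v⟫ - η u * η v) :
    ∀ (r : ℕ) (hr : 1 ≤ r),
      Alt (fun x : Fin (4 * r) → V => AprimeIter φ r x) =
      Alt (fun x : Fin (4 * r) → V =>
        ((-1 : ℝ) ^ (r - 1) * 4 ^ r *
            ∏ i : Fin (2 * r - 1),
              Phi φ (x ⟨2 * (i : ℕ), by have := i.2; omega⟩)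
                (x ⟨2 * (i : ℕ) + 1, by have := i.2; omega⟩)) •
          Bstar φ (x ⟨4 * r - 2, by omega⟩) (x ⟨4 * r - 1, by omega⟩)) := by
  have hξ : ∀ v, ⟪ξ, v⟫ = η v := by
    intro v
    have := hmetric ξ v
    rw [hφξ, inner_zero_left, hηξ] at this; linarith
  have hs : ∀ u v, ⟪φ u, v⟫ = -⟪u, φ v⟫ := by
    intro u v
    have := hmetric u (φ v)
    rw [hηφ, hφφ, inner_add_right, inner_neg_right, inner_smul_right,
      real_inner_comm, real_inner_comm ξ (φ u), hξ, hηφ] at this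
    rw [real_inner_comm]; linarith
  have h3 : ∀ v, φ (φ (φ v)) = - φ v := by
    intro v; rw [hφφ, hηφ]; simp
  intro r hr
  obtain ⟨m, rfl⟩ : ∃ m, r = m + 1 := ⟨r - 1, by omega⟩
  have hpos : 0 < 4 * (m + 1) := by omega
  let ix : ℕ → Fin (4 * (m + 1)) := fun i => ⟨i % (4 * (m + 1)), Nat.mod_lt _ hpos⟩
  have hix : ∀ i (h : i < 4 * (m + 1)), (⟨i, h⟩ : Fin (4 * (m + 1))) = ix i :=
    fun i h => Fin.ext (Nat.mod_eq_of_lt h).symm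
  have hinj : ∀ i j, i < 4 * (m + 1) → j < 4 * (m + 1) → i ≠ j → ix i ≠ ix j := by
    intro i j hi hj hij h
    rw [← hix i hi, ← hix j hj] at h
    exact hij (Fin.mk.inj h)
  funext x v
  have hA : ∀ (T : (Fin (4 * (m + 1)) → V) → (V → V)), Alt T x v = Alt (fun y => T y v) x := by
    intro T
    simp [Alt, Finset.sum_apply]
  rw [hA, hA]
  have hmain := main_ind φ hs h3 (fun j => ix (4 * j + 2)) (fun j => ix (4 * j + 3))
    (ix (4 * m + 2)) (ix (4 * m + 3)) (hinj _ _ (by omega) (by omega) (by omega)) v m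
    (fun x => ∏ j ∈ Finset.range (m + 1), (4 * Phi φ (x (ix (4 * j))) (x (ix (4 * j + 1)))))
    (by
      intro τ hτ x
      refine Finset.prod_congr rfl fun j hj => ?_
      have hj := Finset.mem_range.1 hj
      dsimp only
      have fx : ∀ k, k < 4 * (m + 1) → (∀ j, k ≠ 4 * j + 2 ∧ k ≠ 4 * j + 3) → τ (ix k) = ix k := by
        intro k hk hk2
        exact hτ _ (fun j hj => ⟨hinj _ _ hk (by omega) (hk2 j).1, hinj _ _ hk (by omega) (hk2 j).2⟩)
          (hinj _ _ hk (by omega) (hk2 m).1) (hinj _ _ hk (by omega) (hk2 m).2)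
      rw [fx _ (by omega) (by omega), fx _ (by omega) (by omega)])
    (by
      intro j hj
      refine ⟨?_, ?_, ?_, ?_, ?_⟩ <;> exact hinj _ _ (by omega) (by omega) (by omega))
    (by
      intro j hj k hk
      refine ⟨?_, ?_, ?_, ?_⟩ <;> exact hinj _ _ (by omega) (by omega) (by omega))
  refine Eq.trans (congrFun (congrArg Alt (funext fun y => ?_)) x)
    ((congrFun hmain x).trans (congrFun (congrArg Alt (funext fun y => ?_)) x))
  · have h := foldr_CC (fun j => (4 * Phi φ (y (ix (4 * j))) (y (ix (4 * j + 1)))) •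
      BL φ (y (ix (4 * j + 2))) (y (ix (4 * j + 3)))) (m + 1) id v
    rw [CC_smul] at h
    simp only [AprimeIter, hix]
    exact h
  · have h := prod_split (fun i => Phi φ (y (ix (2 * i))) (y (ix (2 * i + 1)))) m
    have e1 : ∀ j, 2 * (2 * j) = 4 * j := by intro j; ring
    have e2 : ∀ j, 2 * (2 * j + 1) = 4 * j + 2 := by intro j; ring
    simp only [e1, e2] at h
    rw [h]
    simp only [hix, Pi.smul_apply]
    rw [Fin.prod_univ_eq_prod_range
      (fun i => Phi φ (y (ix (2 * i))) (y (ix (2 * i + 1)))) (2 * (m + 1) - 1)]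
    rfl
end

section
/- Let (V, g) be a finite-dimensional real inner product space, let κ ∈ ℝ, and define R1 : V × V → End(V) by R1(x, y)(z) := κ(g(y, z)x − g(x, z)y). Let T : V × V → End(V) be a bilinear map such that Alt((x, y, z) ↦ T(x, y)(z)) = 0 (first Bianchi identity) and each T(x, y) is g-skew-adjoint, i.e. g(T(x, y)(u), v) = −g(u, T(x, y)(v)) for all u, v. Then Alt((x₁, x₂, x₃, x₄) ↦ R1(x₁, x₂) ∘ T(x₃, x₄)) = 0 and Alt((x₁, x₂, x₃, x₄) ↦ T(x₁, x₂) ∘ R1(x₃, x₄)) = 0 as End(V)-valued alternating 4-multilinear maps. -/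
open scoped RealInnerProductSpace

/-- The constant-curvature tensor `R1(x,y)(z) = κ(g(y,z)x − g(x,z)y)`. -/
noncomputable def R1 {V : Type*} [NormedAddCommGroup V] [InnerProductSpace ℝ V]
    (κ : ℝ) (x y z : V) : V :=
  κ • (⟪y, z⟫ • x - ⟪x, z⟫ • y)

theorem sum_perm_succ_aux_s16 {W : Type*} [AddCommGroup W] {n : ℕ} (f : Equiv.Perm (Fin (n+1)) → W) :
    ∑ σ, f σ = ∑ p : Fin (n+1), ∑ e : Equiv.Perm (Fin n), f (Equiv.Perm.decomposeFin.symm (p, e)) := by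
  rw [← Equiv.sum_comp Equiv.Perm.decomposeFin.symm f, Fintype.sum_prod_type]

theorem sum_perm3_aux {V W : Type*} [AddCommGroup W] (f : V → V → V → W) (x : Fin 3 → V) :
    ∑ σ : Equiv.Perm (Fin 3), (Equiv.Perm.sign σ : ℤ) • f (x (σ 0)) (x (σ 1)) (x (σ 2)) =
      f (x 0) (x 1) (x 2) - f (x 0) (x 2) (x 1) - f (x 1) (x 0) (x 2) + f (x 1) (x 2) (x 0)
      + f (x 2) (x 0) (x 1) - f (x 2) (x 1) (x 0) := by
  have hu : (Finset.univ : Finset (Equiv.Perm (Fin 3))) =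
      {1, Equiv.swap 1 2, Equiv.swap 0 1, Equiv.swap 0 1 * Equiv.swap 1 2,
        Equiv.swap 0 2 * Equiv.swap 1 2, Equiv.swap 0 2} := by decide
  have ev : ∀ (σ : Equiv.Perm (Fin 3)) (s : ℤ) (i j k : Fin 3),
      ((Equiv.Perm.sign σ : ℤ) = s ∧ σ 0 = i ∧ σ 1 = j ∧ σ 2 = k) →
      (Equiv.Perm.sign σ : ℤ) • f (x (σ 0)) (x (σ 1)) (x (σ 2)) = s • f (x i) (x j) (x k) := by
    rintro σ s i j k ⟨rfl, rfl, rfl, rfl⟩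
    rfl
  rw [hu, Finset.sum_insert (by decide), Finset.sum_insert (by decide), Finset.sum_insert (by decide),
    Finset.sum_insert (by decide), Finset.sum_insert (by decide), Finset.sum_singleton,
    ev 1 1 0 1 2 (by decide), ev (Equiv.swap 1 2) (-1) 0 2 1 (by decide),
    ev (Equiv.swap 0 1) (-1) 1 0 2 (by decide),
    ev (Equiv.swap 0 1 * Equiv.swap 1 2) 1 1 2 0 (by decide),
    ev (Equiv.swap 0 2 * Equiv.swap 1 2) 1 2 0 1 (by decide),
    ev (Equiv.swap 0 2) (-1) 2 1 0 (by decide)]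
  simp only [one_smul, neg_smul]
  abel

theorem sum_perm4_aux {V W : Type*} [AddCommGroup W] (f : V → V → V → V → W) (x : Fin 4 → V) :
    ∑ σ : Equiv.Perm (Fin 4), (Equiv.Perm.sign σ : ℤ) • f (x (σ 0)) (x (σ 1)) (x (σ 2)) (x (σ 3)) =
      ∑ p : Fin 4, (if p = 0 then (1:ℤ) else -1) •
       ∑ e : Equiv.Perm (Fin 3), (Equiv.Perm.sign e : ℤ) •
        f (x p) (x (Equiv.swap 0 p (e 0).succ)) (x (Equiv.swap 0 p (e 1).succ)) (x (Equiv.swap 0 p (e 2).succ)) := by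
  have h3 : (3 : Fin 4) = Fin.succ 2 := rfl
  have h2 : (2 : Fin 4) = Fin.succ 1 := rfl
  have h1 : (1 : Fin 4) = Fin.succ 0 := rfl
  rw [sum_perm_succ_aux_s16]
  refine Finset.sum_congr rfl fun p _ => ?_
  rw [Finset.smul_sum]
  refine Finset.sum_congr rfl fun e _ => ?_
  rw [h3, h2, h1]
  simp only [Equiv.Perm.decomposeFin_symm_apply_succ, Equiv.Perm.decomposeFin_symm_apply_zero,
    Equiv.Perm.decomposeFin.symm_sign, smul_smul]
  split_ifs <;> simp

theorem sum_perm4_aux' {V W : Type*} [AddCommGroup W] (f : V → V → V → V → W) (x : Fin 4 → V)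
    (g : V → V → V → V → W)
    (hg : ∀ p a b c, g p a b c = f p a b c - f p a c b - f p b a c + f p b c a + f p c a b - f p c b a) :
    ∑ σ : Equiv.Perm (Fin 4), (Equiv.Perm.sign σ : ℤ) • f (x (σ 0)) (x (σ 1)) (x (σ 2)) (x (σ 3)) =
      g (x 0) (x 1) (x 2) (x 3) - g (x 1) (x 0) (x 2) (x 3) - g (x 2) (x 1) (x 0) (x 3)
        - g (x 3) (x 1) (x 2) (x 0) := by
  rw [sum_perm4_aux]
  have key : ∀ p : Fin 4, ∑ e : Equiv.Perm (Fin 3), (Equiv.Perm.sign e : ℤ) •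
        f (x p) (x (Equiv.swap 0 p (e 0).succ)) (x (Equiv.swap 0 p (e 1).succ)) (x (Equiv.swap 0 p (e 2).succ))
      = g (x p) (x (Equiv.swap 0 p 1)) (x (Equiv.swap 0 p 2)) (x (Equiv.swap 0 p 3)) := by
    intro p
    rw [hg]
    exact sum_perm3_aux (f (x p)) (fun i => x (Equiv.swap 0 p i.succ))
  simp only [key, Fin.sum_univ_four]
  have e1 : ∀ p i j : Fin 4, Equiv.swap 0 p i = j → x (Equiv.swap 0 p i) = x j := by
    intro p i j h; rw [h]
  rw [e1 0 1 1 (by decide), e1 0 2 2 (by decide), e1 0 3 3 (by decide),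
    e1 1 1 0 (by decide), e1 1 2 2 (by decide), e1 1 3 3 (by decide),
    e1 2 1 1 (by decide), e1 2 2 0 (by decide), e1 2 3 3 (by decide),
    e1 3 1 1 (by decide), e1 3 2 2 (by decide), e1 3 3 0 (by decide)]
  simp
  abel

theorem R1_comp_T_alternatization_zero
    {V : Type*} [NormedAddCommGroup V] [InnerProductSpace ℝ V] [FiniteDimensional ℝ V]
    (κ : ℝ)
    (T : V →ₗ[ℝ] V →ₗ[ℝ] (V →ₗ[ℝ] V))
    (hBianchi : Alt (fun x : Fin 3 → V => T (x 0) (x 1) (x 2)) = 0)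
    (hskew : ∀ x y u v : V, ⟪T x y u, v⟫ = -⟪u, T x y v⟫) :
    Alt (fun x : Fin 4 → V => fun v => R1 κ (x 0) (x 1) (T (x 2) (x 3) v)) = 0 ∧
    Alt (fun x : Fin 4 → V => fun v => T (x 0) (x 1) (R1 κ (x 2) (x 3) v)) = 0 := by
  have hB : ∀ a b c : V, T a b c - T a c b - T b a c + T b c a + T c a b - T c b a = 0 := by
    intro a b c
    have h := congrFun hBianchi ![a, b, c]
    simp only [Alt] at h
    rw [sum_perm3_aux (fun a b c => T a b c)] at h
    simpa [Nat.factorial] using h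
  have hB' : ∀ v a b c : V, ⟪T a b c, v⟫ - ⟪T a c b, v⟫ - ⟪T b a c, v⟫ + ⟪T b c a, v⟫
      + ⟪T c a b, v⟫ - ⟪T c b a, v⟫ = 0 := by
    intro v a b c
    have h := congrArg (fun w => ⟪w, v⟫) (hB a b c)
    simpa only [inner_add_left, inner_sub_left, inner_zero_left] using h
  have hs : ∀ x y u v : V, ⟪u, T x y v⟫ = -⟪T x y u, v⟫ := by
    intro x y u v
    rw [hskew, neg_neg]
  constructor
  · funext x
    simp only [Alt]
    rw [sum_perm4_aux' (fun a b c d => fun v => R1 κ a b (T c d v)) x _ (fun _ _ _ _ => rfl)]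
    funext v
    simp only [Pi.smul_apply, Pi.sub_apply, Pi.add_apply, Pi.zero_apply, R1, hs]
    refine smul_eq_zero_of_right _ ?_
    generalize x 0 = a, x 1 = b, x 2 = c, x 3 = d
    linear_combination (norm := module) (-2 * κ) • (hB' v b c d) • a + (2 * κ) • (hB' v a c d) • b
      + (-2 * κ) • (hB' v a b d) • c + (2 * κ) • (hB' v a b c) • d
  · funext x
    simp only [Alt]
    rw [sum_perm4_aux' (fun a b c d => fun v => T a b (R1 κ c d v)) x _ (fun _ _ _ _ => rfl)]
    funext v
    simp only [Pi.smul_apply, Pi.sub_apply, Pi.add_apply, Pi.zero_apply, R1, map_smul, map_sub]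
    refine smul_eq_zero_of_right _ ?_
    generalize x 0 = a, x 1 = b, x 2 = c, x 3 = d
    linear_combination (norm := module) (2 * κ * ⟪d, v⟫) • hB a b c - (2 * κ * ⟪c, v⟫) • hB a b d
      + (2 * κ * ⟪b, v⟫) • hB a c d - (2 * κ * ⟪a, v⟫) • hB b c d
end

section
/- Let (φ, ξ, η) be an almost contact metric structure on a finite-dimensional real inner product space (V, g). Then for all E, F ∈ {1, 2, 3, 4} with (E, F) ≠ (2, 2), the End(V)-valued 4-multilinear map (x₁, x₂, x₃, x₄) ↦ CR_E(x₁, x₂) ∘ CR_F(x₃, x₄) has vanishing alternatization. -/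
open scoped RealInnerProductSpace

/-- The family `CR_E` for `E = 1, 2, 3, 4` (and `0` otherwise):
`CR1(x,y)(z) = g(y,z)x − g(x,z)y`,
`CR2(x,y)(z) = Φ(x,z)φ(y) − Φ(y,z)φ(x) + 2Φ(x,y)φ(z)`,
`CR3(x,y)(z) = g(x,z)η(y)ξ − g(y,z)η(x)ξ`,
`CR4(x,y)(z) = η(x)η(z)y − η(y)η(z)x`. -/
noncomputable def CR {V : Type*} [NormedAddCommGroup V] [InnerProductSpace ℝ V]
    (φ : V →ₗ[ℝ] V) (ξ : V) (η : V →ₗ[ℝ] ℝ) : ℕ → V → V → V → V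
  | 1 => fun x y z => ⟪y, z⟫ • x - ⟪x, z⟫ • y
  | 2 => fun x y z => Phi φ x z • φ y - Phi φ y z • φ x + (2 * Phi φ x y) • φ z
  | 3 => fun x y z => (⟪x, z⟫ * η y) • ξ - (⟪y, z⟫ * η x) • ξ
  | 4 => fun x y z => (η x * η z) • y - (η y * η z) • x
  | _ => fun _ _ _ => 0


theorem alt_four_aux {V W : Type*} [AddCommGroup W] [Module ℝ W]
    (f : V → V → V → V → W)
    (h1 : ∀ a b c d, f b a c d = - f a b c d)
    (h2 : ∀ a b c d, f a b d c = - f a b c d)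
    (h : ∀ a b c d, f a b c d - f a c b d + f a d b c + f b c a d - f b d a c + f c d a b = 0) :
    Alt (fun x : Fin 4 → V => f (x 0) (x 1) (x 2) (x 3)) = 0 := by
  funext x
  simp only [Alt, Pi.zero_apply]
  have key : (∑ σ : Equiv.Perm (Fin 4), (Equiv.Perm.sign σ : ℤ) •
      f (x (σ 0)) (x (σ 1)) (x (σ 2)) (x (σ 3))) = 0 := by
    have e : ∀ F : Equiv.Perm (Fin 4) → W, ∑ σ, F σ =
        ∑ p : Fin 4 × Equiv.Perm (Fin 3), F (Equiv.Perm.decomposeFin.symm p) :=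
      fun F => (Equiv.sum_comp _ F).symm
    have e3 : ∀ F : Equiv.Perm (Fin 3) → W, ∑ σ, F σ =
        ∑ p : Fin 3 × Equiv.Perm (Fin 2), F (Equiv.Perm.decomposeFin.symm p) :=
      fun F => (Equiv.sum_comp _ F).symm
    have e2 : ∀ F : Equiv.Perm (Fin 2) → W, ∑ σ, F σ = F 1 + F (Equiv.swap 0 1) := by
      intro F
      have : (Finset.univ : Finset (Equiv.Perm (Fin 2))) = {1, Equiv.swap 0 1} := by decide
      rw [this, Finset.sum_pair (by decide)]
    rw [e]
    simp only [Fintype.sum_prod_type, Fin.sum_univ_four]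
    simp only [e3, Fintype.sum_prod_type, Fin.sum_univ_three, e2]
    have ev : ∀ (σ : Equiv.Perm (Fin 4)) (s : ℤ) (a b c d : Fin 4),
        ((Equiv.Perm.sign σ : ℤ) = s ∧ σ 0 = a ∧ σ 1 = b ∧ σ 2 = c ∧ σ 3 = d) →
        (Equiv.Perm.sign σ : ℤ) • f (x (σ 0)) (x (σ 1)) (x (σ 2)) (x (σ 3))
          = s • f (x a) (x b) (x c) (x d) := by
      rintro σ s a b c d ⟨rfl, rfl, rfl, rfl, rfl⟩; rfl
    rw [ev (Equiv.Perm.decomposeFin.symm (0, Equiv.Perm.decomposeFin.symm (0, 1))) (1) 0 1 2 3 (by decide),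
      ev (Equiv.Perm.decomposeFin.symm (0, Equiv.Perm.decomposeFin.symm (0, Equiv.swap 0 1))) (-1) 0 1 3 2 (by decide),
      ev (Equiv.Perm.decomposeFin.symm (0, Equiv.Perm.decomposeFin.symm (1, 1))) (-1) 0 2 1 3 (by decide),
      ev (Equiv.Perm.decomposeFin.symm (0, Equiv.Perm.decomposeFin.symm (1, Equiv.swap 0 1))) (1) 0 2 3 1 (by decide),
      ev (Equiv.Perm.decomposeFin.symm (0, Equiv.Perm.decomposeFin.symm (2, 1))) (-1) 0 3 2 1 (by decide),
      ev (Equiv.Perm.decomposeFin.symm (0, Equiv.Perm.decomposeFin.symm (2, Equiv.swap 0 1))) (1) 0 3 1 2 (by decide),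
      ev (Equiv.Perm.decomposeFin.symm (1, Equiv.Perm.decomposeFin.symm (0, 1))) (-1) 1 0 2 3 (by decide),
      ev (Equiv.Perm.decomposeFin.symm (1, Equiv.Perm.decomposeFin.symm (0, Equiv.swap 0 1))) (1) 1 0 3 2 (by decide),
      ev (Equiv.Perm.decomposeFin.symm (1, Equiv.Perm.decomposeFin.symm (1, 1))) (1) 1 2 0 3 (by decide),
      ev (Equiv.Perm.decomposeFin.symm (1, Equiv.Perm.decomposeFin.symm (1, Equiv.swap 0 1))) (-1) 1 2 3 0 (by decide),
      ev (Equiv.Perm.decomposeFin.symm (1, Equiv.Perm.decomposeFin.symm (2, 1))) (1) 1 3 2 0 (by decide),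
      ev (Equiv.Perm.decomposeFin.symm (1, Equiv.Perm.decomposeFin.symm (2, Equiv.swap 0 1))) (-1) 1 3 0 2 (by decide),
      ev (Equiv.Perm.decomposeFin.symm (2, Equiv.Perm.decomposeFin.symm (0, 1))) (-1) 2 1 0 3 (by decide),
      ev (Equiv.Perm.decomposeFin.symm (2, Equiv.Perm.decomposeFin.symm (0, Equiv.swap 0 1))) (1) 2 1 3 0 (by decide),
      ev (Equiv.Perm.decomposeFin.symm (2, Equiv.Perm.decomposeFin.symm (1, 1))) (1) 2 0 1 3 (by decide),
      ev (Equiv.Perm.decomposeFin.symm (2, Equiv.Perm.decomposeFin.symm (1, Equiv.swap 0 1))) (-1) 2 0 3 1 (by decide),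
      ev (Equiv.Perm.decomposeFin.symm (2, Equiv.Perm.decomposeFin.symm (2, 1))) (1) 2 3 0 1 (by decide),
      ev (Equiv.Perm.decomposeFin.symm (2, Equiv.Perm.decomposeFin.symm (2, Equiv.swap 0 1))) (-1) 2 3 1 0 (by decide),
      ev (Equiv.Perm.decomposeFin.symm (3, Equiv.Perm.decomposeFin.symm (0, 1))) (-1) 3 1 2 0 (by decide),
      ev (Equiv.Perm.decomposeFin.symm (3, Equiv.Perm.decomposeFin.symm (0, Equiv.swap 0 1))) (1) 3 1 0 2 (by decide),
      ev (Equiv.Perm.decomposeFin.symm (3, Equiv.Perm.decomposeFin.symm (1, 1))) (1) 3 2 1 0 (by decide),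
      ev (Equiv.Perm.decomposeFin.symm (3, Equiv.Perm.decomposeFin.symm (1, Equiv.swap 0 1))) (-1) 3 2 0 1 (by decide),
      ev (Equiv.Perm.decomposeFin.symm (3, Equiv.Perm.decomposeFin.symm (2, 1))) (1) 3 0 2 1 (by decide),
      ev (Equiv.Perm.decomposeFin.symm (3, Equiv.Perm.decomposeFin.symm (2, Equiv.swap 0 1))) (-1) 3 0 1 2 (by decide)]
    have H := h (x 0) (x 1) (x 2) (x 3)
    simp only [h1 (x 0) (x 1), h1 (x 0) (x 2), h1 (x 0) (x 3), h1 (x 1) (x 2), h1 (x 1) (x 3),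
      h1 (x 2) (x 3), h2 _ _ (x 0) (x 1), h2 _ _ (x 0) (x 2), h2 _ _ (x 0) (x 3),
      h2 _ _ (x 1) (x 2), h2 _ _ (x 1) (x 3), h2 _ _ (x 2) (x 3)]
    linear_combination (norm := module) (4 : ℝ) • H
  rw [key, smul_zero]

theorem CR_compositions_alternatization_zero
    {V : Type*} [NormedAddCommGroup V] [InnerProductSpace ℝ V] [FiniteDimensional ℝ V]
    (φ : V →ₗ[ℝ] V) (ξ : V) (η : V →ₗ[ℝ] ℝ)
    (hφφ : ∀ v, φ (φ v) = -v + η v • ξ)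
    (hηξ : η ξ = 1)
    (hφξ : φ ξ = 0)
    (hηφ : ∀ v, η (φ v) = 0)
    (hmetric : ∀ u v, ⟪φ u, φ v⟫ = ⟪u, v⟫ - η u * η v) :
    ∀ E F : ℕ, (E = 1 ∨ E = 2 ∨ E = 3 ∨ E = 4) → (F = 1 ∨ F = 2 ∨ F = 3 ∨ F = 4) →
      (E, F) ≠ (2, 2) →
      Alt (fun x : Fin 4 → V => fun v =>
          CR φ ξ η E (x 0) (x 1) (CR φ ξ η F (x 2) (x 3) v)) = 0 := by
  have hηg : ∀ v, ⟪ξ, v⟫ = η v := by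
    intro v
    have := hmetric ξ v
    rw [hφξ, inner_zero_left, hηξ] at this
    linarith
  have hηg' : ∀ v, ⟪v, ξ⟫ = η v := fun v => by rw [real_inner_comm, hηg]
  have hsk : ∀ u v, ⟪u, φ v⟫ = - ⟪φ u, v⟫ := by
    intro u v
    have := hmetric u (φ v)
    rw [hφφ, hηφ, inner_add_right, inner_neg_right, inner_smul_right, hηg', hηφ] at this
    linarith
  have hsk' : ∀ u v, ⟪φ v, u⟫ = - ⟪φ u, v⟫ := fun u v => by rw [← hsk, real_inner_comm]
  have hanti : ∀ E a b v, CR φ ξ η E b a v = - CR φ ξ η E a b v := by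
    intro E a b v
    unfold CR
    split
    · module
    · simp only [Phi, hsk' a b]; module
    · module
    · module
    · simp
  have hneg : ∀ E a b v, CR φ ξ η E a b (-v) = - CR φ ξ η E a b v := by
    intro E a b v
    unfold CR
    split <;> simp only [Phi, inner_neg_right, map_neg] <;> (try module)
  intro E F hE hF hEF
  refine alt_four_aux (fun a b c d v => CR φ ξ η E a b (CR φ ξ η F c d v)) ?_ ?_ ?_
  · intro a b c d; funext v; exact hanti _ _ _ _
  · intro a b c d; funext v
    simp only [Pi.neg_apply]
    rw [hanti F c d, hneg]
  · intro a b c d; funext v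
    simp only [Pi.add_apply, Pi.sub_apply, Pi.zero_apply]
    rcases hE with rfl | rfl | rfl | rfl <;> rcases hF with rfl | rfl | rfl | rfl <;>
    first
    | exact absurd rfl hEF
    | (simp only [CR, Phi, inner_add_right, inner_sub_right, inner_smul_right, map_add, map_sub,
        map_smul, smul_eq_mul, hηφ, hφξ, hηξ, hηg, hηg', hsk, inner_zero_right, smul_zero,
        real_inner_comm a b, real_inner_comm a c, real_inner_comm a d, real_inner_comm b c,
        real_inner_comm b d, real_inner_comm c d, hsk' a b, hsk' a c, hsk' a d, hsk' b c,
        hsk' b d, hsk' c d]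
       module)
end
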